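/- Let N ≥ 2, strictly sorted channel gains 0 < h_1 < h_2 < … < h_N, σ² > 0, α > 0, R̄_1, …, R̄_N ≥ 0, and P_max > 0, and assume the feasibility condition (σ²/α)·Σ_{l=1}^{N} (Π_{m=1}^{l−1} 2^{R̄_m})·(2^{R̄_l} − 1)/h_l² ≤ P_max. Then the maximum of the per-beam sum rate Σ_{i=1}^{N} R_i(p) over all p ≥ 0 with Σ_{i=1}^{N} p_i ≤ P_max and R_i(p) ≥ R̄_i for all i exists and equals log₂(1 + α·P_max·h_N²/(σ²·Π_{i=1}^{N−1} 2^{R̄_i}) − Σ_{i=1}^{N−1} h_N²·(2^{R̄_i} − 1)/(h_i²·Π_{l=i}^{N−1} 2^{R̄_l})) + Σ_{i=1}^{N−1} R̄_i; it is achieved by the allocation that meets the rate constraints of users 1, …, N−1 with equality and assigns all remaining power to user N. -/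

import Mathlib

open Finset

/-- Cumulative power `a_i = Σ_{l=i}^{N} p_l` (so `a_{N+1} = 0`). -/
noncomputable def cumPow (N : ℕ) (p : ℕ → ℝ) (i : ℕ) : ℝ := ∑ l ∈ Finset.Icc i N, p l

/-- Per-user SIC rate `R_i(p) = log₂((hᵢ²·aᵢ(p) + c)/(hᵢ²·a_{i+1}(p) + c))`, `c = σ²/α`. -/
noncomputable def rate (N : ℕ) (h : ℕ → ℝ) (c : ℝ) (p : ℕ → ℝ) (i : ℕ) : ℝ :=
  Real.logb 2 (((h i) ^ 2 * cumPow N p i + c) / ((h i) ^ 2 * cumPow N p (i + 1) + c))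

/-- Per-beam sum rate `f(p) = Σ_{i=1}^{N} R_i(p)`. -/
noncomputable def sumRate (N : ℕ) (h : ℕ → ℝ) (c : ℝ) (p : ℕ → ℝ) : ℝ :=
  ∑ i ∈ Finset.Icc 1 N, rate N h c p i

/-- Cumulative power left for users `k + 1, …, N` when users `1, …, k` are served exactly at
their minimum rates out of a total budget `P`. -/
noncomputable def residualPow (h Rbar : ℕ → ℝ) (c P : ℝ) (k : ℕ) : ℝ :=
  (P - c * ∑ l ∈ Icc 1 k, (∏ m ∈ Icc 1 (l - 1), (2 : ℝ) ^ Rbar m) *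
    ((2 : ℝ) ^ Rbar l - 1) / h l ^ 2) / ∏ m ∈ Icc 1 k, (2 : ℝ) ^ Rbar m

lemma residualPow_zero (h Rbar : ℕ → ℝ) (c P : ℝ) : residualPow h Rbar c P 0 = P := by
  simp [residualPow]

lemma prod_two_rpow_pos (Rbar : ℕ → ℝ) (s : Finset ℕ) : 0 < ∏ m ∈ s, (2 : ℝ) ^ Rbar m :=
  prod_pos fun _ _ => by positivity

lemma residualPow_step {h : ℕ → ℝ} (Rbar : ℕ → ℝ) (c P : ℝ) {k : ℕ} (hk : 0 < h (k + 1)) :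
    h (k + 1) ^ 2 * residualPow h Rbar c P k + c =
      (2 : ℝ) ^ Rbar (k + 1) * (h (k + 1) ^ 2 * residualPow h Rbar c P (k + 1) + c) := by
  have hprod := prod_two_rpow_pos Rbar (Icc 1 k)
  have hr : (0 : ℝ) < 2 ^ Rbar (k + 1) := by positivity
  unfold residualPow
  rw [sum_Icc_succ_top (by omega), prod_Icc_succ_top (by omega), Nat.add_sub_cancel]
  field_simp
  ring

lemma le_residualPow {N : ℕ} {h Rbar : ℕ → ℝ} {c P : ℝ} (hc : 0 < c)
    (hR : ∀ i ∈ Icc 1 N, 0 ≤ Rbar i)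
    (hfeas : c * ∑ l ∈ Icc 1 N, (∏ m ∈ Icc 1 (l - 1), (2 : ℝ) ^ Rbar m) *
      ((2 : ℝ) ^ Rbar l - 1) / h l ^ 2 ≤ P) {k : ℕ} (hk : k < N) :
    c * ((2 : ℝ) ^ Rbar (k + 1) - 1) / h (k + 1) ^ 2 ≤ residualPow h Rbar c P k := by
  have hprod := prod_two_rpow_pos Rbar (Icc 1 k)
  have hsum : ∑ l ∈ Icc 1 (k + 1), (∏ m ∈ Icc 1 (l - 1), (2 : ℝ) ^ Rbar m) *
      ((2 : ℝ) ^ Rbar l - 1) / h l ^ 2 ≤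
      ∑ l ∈ Icc 1 N, (∏ m ∈ Icc 1 (l - 1), (2 : ℝ) ^ Rbar m) *
        ((2 : ℝ) ^ Rbar l - 1) / h l ^ 2 := by
    refine sum_le_sum_of_subset_of_nonneg (Icc_subset_Icc_right hk) fun l hl _ => ?_
    have := Real.one_le_rpow one_le_two (hR l hl)
    exact div_nonneg (mul_nonneg (prod_two_rpow_pos _ _).le (by linarith)) (sq_nonneg _)
  rw [sum_Icc_succ_top (by omega), Nat.add_sub_cancel] at hsum
  rw [residualPow, le_div_iff₀ hprod, le_sub_iff_add_le]
  calc _ = c * (∑ l ∈ Icc 1 k, (∏ m ∈ Icc 1 (l - 1), (2 : ℝ) ^ Rbar m) *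
        ((2 : ℝ) ^ Rbar l - 1) / h l ^ 2 + (∏ m ∈ Icc 1 k, (2 : ℝ) ^ Rbar m) *
        ((2 : ℝ) ^ Rbar (k + 1) - 1) / h (k + 1) ^ 2) := by ring
    _ ≤ _ := mul_le_mul_of_nonneg_left hsum hc.le
    _ ≤ P := hfeas

lemma residualPow_nonneg {N : ℕ} {h Rbar : ℕ → ℝ} {c P : ℝ} (hc : 0 < c)
    (hR : ∀ i ∈ Icc 1 N, 0 ≤ Rbar i)
    (hfeas : c * ∑ l ∈ Icc 1 N, (∏ m ∈ Icc 1 (l - 1), (2 : ℝ) ^ Rbar m) *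
      ((2 : ℝ) ^ Rbar l - 1) / h l ^ 2 ≤ P) {k : ℕ} (hk : k < N) :
    0 ≤ residualPow h Rbar c P k := by
  have := Real.one_le_rpow one_le_two (hR (k + 1) (mem_Icc.2 ⟨by omega, hk⟩))
  exact (div_nonneg (mul_nonneg hc.le (by linarith)) (sq_nonneg _)).trans
    (le_residualPow hc hR hfeas hk)

lemma residualPow_closed_form {h : ℕ → ℝ} (Rbar : ℕ → ℝ) {σ2 α : ℝ} (hσ : 0 < σ2) (hα : 0 < α)
    (P g : ℝ) (k : ℕ) :
    1 + α * P * g ^ 2 / (σ2 * ∏ i ∈ Icc 1 k, (2 : ℝ) ^ Rbar i) -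
      ∑ i ∈ Icc 1 k, g ^ 2 * ((2 : ℝ) ^ Rbar i - 1) /
        (h i ^ 2 * ∏ l ∈ Icc i k, (2 : ℝ) ^ Rbar l) =
      (g ^ 2 * residualPow h Rbar (σ2 / α) P k + σ2 / α) / (σ2 / α) := by
  have hprod := prod_two_rpow_pos Rbar (Icc 1 k)
  have hsum : ∑ i ∈ Icc 1 k, g ^ 2 * ((2 : ℝ) ^ Rbar i - 1) /
        (h i ^ 2 * ∏ l ∈ Icc i k, (2 : ℝ) ^ Rbar l) =
      g ^ 2 / (∏ m ∈ Icc 1 k, (2 : ℝ) ^ Rbar m) *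
        ∑ l ∈ Icc 1 k, (∏ m ∈ Icc 1 (l - 1), (2 : ℝ) ^ Rbar m) *
          ((2 : ℝ) ^ Rbar l - 1) / h l ^ 2 := by
    rw [mul_sum]
    refine sum_congr rfl fun i hi => ?_
    obtain ⟨h1, h2⟩ := mem_Icc.1 hi
    have hsplit : ∏ m ∈ Icc 1 k, (2 : ℝ) ^ Rbar m =
        (∏ m ∈ Icc 1 (i - 1), (2 : ℝ) ^ Rbar m) * ∏ m ∈ Icc i k, (2 : ℝ) ^ Rbar m := by
      obtain ⟨j, rfl⟩ : ∃ j, i = j + 1 := ⟨i - 1, by omega⟩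
      simp only [← Finset.Ico_add_one_right_eq_Icc, Nat.add_sub_cancel]
      exact (prod_Ico_consecutive _ (by omega) (by omega)).symm
    have ha := prod_two_rpow_pos Rbar (Icc 1 (i - 1))
    have hb := prod_two_rpow_pos Rbar (Icc i k)
    rw [hsplit]
    field_simp
  rw [hsum]
  unfold residualPow
  field_simp
  ring

lemma cumPow_telescope (N : ℕ) (b : ℕ → ℝ) (hb : b (N + 1) = 0) {i : ℕ} (hi : i ≤ N + 1) :
    cumPow N (fun l => b l - b (l + 1)) i = b i := by
  have := sum_Ico_sub b hi
  rw [cumPow, ← Finset.Ico_add_one_right_eq_Icc, ← neg_inj, ← sum_neg_distrib]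
  simp only [neg_sub]
  exact this.trans (by rw [hb, zero_sub])

lemma cumPow_succ_top (N : ℕ) (p : ℕ → ℝ) : cumPow N p (N + 1) = 0 := by
  simp [cumPow]

lemma cumPow_nonneg {N : ℕ} {p : ℕ → ℝ} (hp : ∀ i ∈ Icc 1 N, 0 ≤ p i) (i : ℕ) :
    0 ≤ cumPow N p (i + 1) :=
  sum_nonneg fun l hl => hp l (Icc_subset_Icc_left (by omega) hl)

/-- The rate of the users `1, …, k` in excess of their requirements can only shrink the signal
level of user `k + 1` below the one reached when the requirements are met exactly. -/
lemma excess_rate_bound {N : ℕ} {h Rbar q : ℕ → ℝ} {c P : ℝ} (hc : 0 < c)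
    (hh : ∀ i ∈ Icc 1 N, 0 < h i)
    (hsort : ∀ i ∈ Icc 1 N, ∀ j ∈ Icc 1 N, i < j → h i < h j)
    (hq : ∀ i ∈ Icc 1 N, 0 ≤ q i) (hqP : ∑ i ∈ Icc 1 N, q i ≤ P)
    (hrate : ∀ i ∈ Icc 1 N, Rbar i ≤ rate N h c q i) {k : ℕ} (hk : k < N) :
    (2 : ℝ) ^ (∑ i ∈ Icc 1 k, (rate N h c q i - Rbar i)) *
        (h (k + 1) ^ 2 * cumPow N q (k + 1) + c) ≤
      h (k + 1) ^ 2 * residualPow h Rbar c P k + c := by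
  induction k with
  | zero =>
    rw [residualPow_zero]
    simpa [cumPow] using mul_le_mul_of_nonneg_left hqP (sq_nonneg (h 1))
  | succ k ih =>
    have ih := ih (by omega)
    have hmem : k + 1 ∈ Icc 1 N := mem_Icc.2 ⟨by omega, by omega⟩
    have hmem' : k + 1 + 1 ∈ Icc 1 N := mem_Icc.2 ⟨by omega, by omega⟩
    have hpos := hh _ hmem
    have hlt := hsort _ hmem _ hmem' (by omega)
    have ha := cumPow_nonneg hq k
    have ha' := cumPow_nonneg hq (k + 1)
    have hx : 0 < h (k + 1) ^ 2 * cumPow N q (k + 1) + c := by positivity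
    have hy : 0 < h (k + 1) ^ 2 * cumPow N q (k + 1 + 1) + c := by positivity
    have hr : (0 : ℝ) < 2 ^ Rbar (k + 1) := by positivity
    have hE : (1 : ℝ) ≤ 2 ^ (∑ i ∈ Icc 1 (k + 1), (rate N h c q i - Rbar i)) :=
      Real.one_le_rpow one_le_two <| sum_nonneg fun i hi =>
        sub_nonneg.2 (hrate i (Icc_subset_Icc_right (by omega) hi))
    have hEs : (2 : ℝ) ^ (∑ i ∈ Icc 1 (k + 1), (rate N h c q i - Rbar i)) *
        (h (k + 1) ^ 2 * cumPow N q (k + 1 + 1) + c) * 2 ^ Rbar (k + 1) =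
        2 ^ (∑ i ∈ Icc 1 k, (rate N h c q i - Rbar i)) *
          (h (k + 1) ^ 2 * cumPow N q (k + 1) + c) := by
      rw [sum_Icc_succ_top (by omega), Real.rpow_add two_pos, Real.rpow_sub two_pos, rate,
        Real.rpow_logb two_pos (by norm_num) (div_pos hx hy)]
      field_simp
    rw [← hEs, residualPow_step Rbar c P hpos, mul_comm (2 ^ Rbar (k + 1) : ℝ),
      mul_le_mul_iff_left₀ hr] at ih
    set E := (2 : ℝ) ^ (∑ i ∈ Icc 1 (k + 1), (rate N h c q i - Rbar i))
    set a := cumPow N q (k + 1 + 1)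
    set b := residualPow h Rbar c P (k + 1)
    have hsq : h (k + 1) ^ 2 ≤ h (k + 1 + 1) ^ 2 := by gcongr
    have hgap : (E - 1) * c ≤ h (k + 1) ^ 2 * (b - E * a) := by linarith
    have hba : 0 ≤ b - E * a := by
      refine nonneg_of_mul_nonneg_right (le_trans ?_ hgap) (by positivity : 0 < h (k + 1) ^ 2)
      exact mul_nonneg (sub_nonneg.2 hE) hc.le
    linarith [mul_le_mul_of_nonneg_right hsq hba]

lemma sumRate_le {n : ℕ} {h Rbar q : ℕ → ℝ} {c P : ℝ} (hc : 0 < c)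
    (hh : ∀ i ∈ Icc 1 (n + 1), 0 < h i)
    (hsort : ∀ i ∈ Icc 1 (n + 1), ∀ j ∈ Icc 1 (n + 1), i < j → h i < h j)
    (hq : ∀ i ∈ Icc 1 (n + 1), 0 ≤ q i) (hqP : ∑ i ∈ Icc 1 (n + 1), q i ≤ P)
    (hrate : ∀ i ∈ Icc 1 (n + 1), Rbar i ≤ rate (n + 1) h c q i) :
    sumRate (n + 1) h c q ≤
      Real.logb 2 ((h (n + 1) ^ 2 * residualPow h Rbar c P n + c) / c) +
        ∑ i ∈ Icc 1 n, Rbar i := by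
  have hbound := excess_rate_bound hc hh hsort hq hqP hrate (Nat.lt_succ_self n)
  have ha := cumPow_nonneg hq n
  have hx : 0 < h (n + 1) ^ 2 * cumPow (n + 1) q (n + 1) + c := by positivity
  have hlog := Real.logb_le_logb_of_le one_lt_two (by positivity)
    (div_le_div_of_nonneg_right hbound hc.le)
  rw [mul_div_assoc, Real.logb_mul (by positivity) (by positivity),
    Real.logb_rpow two_pos (by norm_num), sum_sub_distrib] at hlog
  rw [sumRate, sum_Icc_succ_top (by omega), rate.eq_1 (n + 1) h c q (n + 1), cumPow_succ_top,
    mul_zero, zero_add]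
  linarith

lemma exists_allocation {n : ℕ} {h Rbar : ℕ → ℝ} {c P : ℝ} (hc : 0 < c)
    (hh : ∀ i ∈ Icc 1 (n + 1), 0 < h i) (hR : ∀ i ∈ Icc 1 (n + 1), 0 ≤ Rbar i)
    (hfeas : c * ∑ l ∈ Icc 1 (n + 1), (∏ m ∈ Icc 1 (l - 1), (2 : ℝ) ^ Rbar m) *
      ((2 : ℝ) ^ Rbar l - 1) / h l ^ 2 ≤ P) :
    ∃ p : ℕ → ℝ,
      (∀ i ∈ Icc 1 (n + 1), 0 ≤ p i) ∧
      (∑ i ∈ Icc 1 (n + 1), p i = P) ∧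
      (∀ i ∈ Icc 1 (n + 1), Rbar i ≤ rate (n + 1) h c p i) ∧
      (∀ i ∈ Icc 1 n, rate (n + 1) h c p i = Rbar i) ∧
      sumRate (n + 1) h c p =
        Real.logb 2 ((h (n + 1) ^ 2 * residualPow h Rbar c P n + c) / c) +
          ∑ i ∈ Icc 1 n, Rbar i := by
  set b : ℕ → ℝ := fun i => if i ≤ n + 1 then residualPow h Rbar c P (i - 1) else 0
  have hb0 : b (n + 1 + 1) = 0 := if_neg (by omega)
  have hb : ∀ k ≤ n, b (k + 1) = residualPow h Rbar c P k := fun k hk =>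
    if_pos (Nat.succ_le_succ hk)
  have hnn : ∀ k ≤ n, 0 ≤ residualPow h Rbar c P k := fun k hk =>
    residualPow_nonneg hc hR hfeas (Nat.lt_succ_of_le hk)
  have hcum : ∀ i ≤ n + 1 + 1, cumPow (n + 1) (fun l => b l - b (l + 1)) i = b i := fun i hi =>
    cumPow_telescope (n + 1) b hb0 hi
  have hstep : ∀ i ∈ Icc 1 n, rate (n + 1) h c (fun l => b l - b (l + 1)) i = Rbar i := by
    intro i hi
    obtain ⟨h1, h2⟩ := mem_Icc.1 hi
    obtain ⟨k, rfl⟩ : ∃ k, i = k + 1 := ⟨i - 1, by omega⟩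
    have hpos : 0 < h (k + 1) := hh _ (mem_Icc.2 ⟨by omega, by omega⟩)
    have hnext := hnn (k + 1) h2
    rw [rate, hcum _ (by omega), hcum _ (by omega), hb _ (by omega), hb _ h2,
      residualPow_step Rbar c P hpos, mul_div_assoc, div_self (by positivity), mul_one,
      Real.logb_rpow two_pos (by norm_num)]
  have hlast : rate (n + 1) h c (fun l => b l - b (l + 1)) (n + 1) =
      Real.logb 2 ((h (n + 1) ^ 2 * residualPow h Rbar c P n + c) / c) := by
    rw [rate, hcum _ (by omega), hcum _ le_rfl, hb n le_rfl, hb0, mul_zero, zero_add]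
  refine ⟨fun l => b l - b (l + 1), fun i hi => ?_, ?_, fun i hi => ?_, hstep, ?_⟩
  · obtain ⟨h1, h2⟩ := mem_Icc.1 hi
    obtain ⟨k, rfl⟩ : ∃ k, i = k + 1 := ⟨i - 1, by omega⟩
    rcases eq_or_lt_of_le h2 with heq | hlt
    · obtain rfl : k = n := by omega
      simpa [hb k le_rfl, hb0] using hnn k le_rfl
    · have hpos := hh _ hi
      have hnext := hnn (k + 1) (by omega)
      have hr := Real.one_le_rpow one_le_two (hR _ hi)
      have hs := residualPow_step Rbar c P hpos
      have hmono : 1 * (h (k + 1) ^ 2 * residualPow h Rbar c P (k + 1) + c) ≤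
          2 ^ Rbar (k + 1) * (h (k + 1) ^ 2 * residualPow h Rbar c P (k + 1) + c) :=
        mul_le_mul_of_nonneg_right hr (by positivity)
      rw [← hs, one_mul, add_le_add_iff_right, mul_le_mul_iff_right₀ (by positivity)] at hmono
      simpa [hb k (by omega), hb (k + 1) (by omega)] using hmono
  · exact (hcum 1 (by omega)).trans ((hb 0 (by omega)).trans (residualPow_zero _ _ _ _))
  · obtain ⟨h1, h2⟩ := mem_Icc.1 hi
    rcases eq_or_lt_of_le h2 with rfl | hlt
    · have hpos := hh _ hi
      have hle := le_residualPow hc hR hfeas (Nat.lt_succ_self n)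
      rw [div_le_iff₀ (by positivity)] at hle
      rw [hlast, Real.le_logb_iff_rpow_le one_lt_two
        (div_pos (add_pos_of_nonneg_of_pos (mul_nonneg (sq_nonneg _) (hnn n le_rfl)) hc) hc),
        le_div_iff₀ hc]
      linarith
    · exact (hstep i (mem_Icc.2 ⟨h1, by omega⟩)).ge
  · rw [sumRate, sum_Icc_succ_top (by omega), hlast, sum_congr rfl hstep, add_comm]

/-- under the feasibility condition, the maximum per-beam sum rate exists and
equals the closed form
`log₂(1 + α·P_max·h_N²/(σ²·Π_{i<N} 2^{R̄ᵢ}) − Σ_{i<N} h_N²·(2^{R̄ᵢ}−1)/(hᵢ²·Π_{l=i}^{N−1} 2^{R̄_l})) + Σ_{i<N} R̄ᵢ`,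
achieved by an allocation meeting the constraints of users `1,…,N−1` with equality and
assigning all remaining power to user `N`. -/
theorem max_sum_rate_closed_form
    (N : ℕ) (hN : 2 ≤ N) (h Rbar : ℕ → ℝ) (σ2 α Pmax : ℝ)
    (hσ : 0 < σ2) (hα : 0 < α) (hP : 0 < Pmax)
    (hh : ∀ i ∈ Finset.Icc 1 N, 0 < h i)
    (hsort : ∀ i ∈ Finset.Icc 1 N, ∀ j ∈ Finset.Icc 1 N, i < j → h i < h j)
    (hR : ∀ i ∈ Finset.Icc 1 N, 0 ≤ Rbar i)
    (hfeas : (σ2 / α) * ∑ l ∈ Finset.Icc 1 N,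
        (∏ m ∈ Finset.Icc 1 (l - 1), (2 : ℝ) ^ (Rbar m)) *
          ((2 : ℝ) ^ (Rbar l) - 1) / (h l) ^ 2 ≤ Pmax) :
    IsGreatest
      ((sumRate N h (σ2 / α)) ''
        {q : ℕ → ℝ | (∀ i ∈ Finset.Icc 1 N, 0 ≤ q i) ∧
          (∑ i ∈ Finset.Icc 1 N, q i ≤ Pmax) ∧
          (∀ i ∈ Finset.Icc 1 N, rate N h (σ2 / α) q i ≥ Rbar i)})
      (Real.logb 2 (1 + α * Pmax * (h N) ^ 2 /
          (σ2 * ∏ i ∈ Finset.Icc 1 (N - 1), (2 : ℝ) ^ (Rbar i)) -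
        ∑ i ∈ Finset.Icc 1 (N - 1), (h N) ^ 2 * ((2 : ℝ) ^ (Rbar i) - 1) /
          ((h i) ^ 2 * ∏ l ∈ Finset.Icc i (N - 1), (2 : ℝ) ^ (Rbar l))) +
        ∑ i ∈ Finset.Icc 1 (N - 1), Rbar i) ∧
    ∃ p : ℕ → ℝ,
      (∀ i ∈ Finset.Icc 1 N, 0 ≤ p i) ∧
      (∑ i ∈ Finset.Icc 1 N, p i = Pmax) ∧
      (∀ i ∈ Finset.Icc 1 N, rate N h (σ2 / α) p i ≥ Rbar i) ∧
      (∀ i ∈ Finset.Icc 1 (N - 1), rate N h (σ2 / α) p i = Rbar i) ∧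
      sumRate N h (σ2 / α) p =
        Real.logb 2 (1 + α * Pmax * (h N) ^ 2 /
            (σ2 * ∏ i ∈ Finset.Icc 1 (N - 1), (2 : ℝ) ^ (Rbar i)) -
          ∑ i ∈ Finset.Icc 1 (N - 1), (h N) ^ 2 * ((2 : ℝ) ^ (Rbar i) - 1) /
            ((h i) ^ 2 * ∏ l ∈ Finset.Icc i (N - 1), (2 : ℝ) ^ (Rbar l))) +
          ∑ i ∈ Finset.Icc 1 (N - 1), Rbar i := by
  obtain ⟨n, rfl⟩ : ∃ n, N = n + 1 := ⟨N - 1, by omega⟩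
  have hc : 0 < σ2 / α := div_pos hσ hα
  rw [Nat.add_sub_cancel, residualPow_closed_form Rbar hσ hα]
  obtain ⟨p, hp, hsum, hrate, heq, hval⟩ := exists_allocation hc hh hR hfeas
  refine ⟨⟨⟨p, ⟨hp, hsum.le, hrate⟩, hval⟩, ?_⟩, p, hp, hsum, hrate, heq, hval⟩
  rintro _ ⟨q, ⟨hq, hqP, hqrate⟩, rfl⟩
  exact sumRate_le hc hh hsort hq hqP hqrate
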